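/- Any local map f: C(b_1,…,b_n) → C(b_1,…,b_n) from a standard complex to itself is injective, and moreover is an isomorphism of bigraded chain complexes over R. -/

import Mathlib

/-!
Common setup: the ring `R = 𝔽₂[U,V]/(UV = 0)`, bigraded free finitely generated chain
complexes over `R` ("pre-complexes"), knot-like complexes, local maps and local
equivalence, standard and semistandard complexes, short maps, the `Z^!` order,
the invariants `a_i`, `φ_j`, `P`, shift maps, tensor products, duals, and direct sums.
-/

set_option synthInstance.maxHeartbeats 1000000
set_option maxHeartbeats 1000000

noncomputable section

/-- The polynomial ring `𝔽₂[U,V]`. -/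
abbrev PolyUV : Type := MvPolynomial (Fin 2) (ZMod 2)

/-- The ideal `(U·V)`. -/
def IUV : Ideal PolyUV := Ideal.span {(MvPolynomial.X 0 * MvPolynomial.X 1 : PolyUV)}

/-- The ring `R = 𝔽₂[U,V]/(UV = 0)`. -/
abbrev RUV : Type := PolyUV ⧸ IUV

instance : CommRing RUV := Ideal.Quotient.commRing IUV

/-- The image of `U` in `R`. -/
def Uv : RUV := Ideal.Quotient.mk IUV (MvPolynomial.X 0)

/-- The image of `V` in `R`. -/
def Vv : RUV := Ideal.Quotient.mk IUV (MvPolynomial.X 1)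

/-- `r ∈ R` is homogeneous of bidegree `(p, q)` for the bigrading with
`gr(U) = (-2, 0)`, `gr(V) = (0, -2)`, `gr(1) = (0, 0)` (coefficients in `𝔽₂`). -/
def IsHomog (r : RUV) (p q : ℤ) : Prop :=
  r = 0 ∨ (∃ a : ℕ, r = Uv ^ a ∧ p = -(2 * (a : ℤ)) ∧ q = 0) ∨
    (∃ b : ℕ, r = Vv ^ b ∧ p = 0 ∧ q = -(2 * (b : ℤ)))

/-- A finitely generated free bigraded module over `R` with a distinguished basis
indexed by `Fin n`, together with a bigrading `gr` on the basis and a matrix `dm`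
recording a prospective differential: `dm i j` is the coefficient of the `j`-th basis
vector in the differential of the `i`-th basis vector. -/
structure PreCx where
  n : ℕ
  gr : Fin n → ℤ × ℤ
  dm : Fin n → Fin n → RUV

/-- The underlying free `R`-module of a pre-complex. -/
abbrev Msub (C : PreCx) : Type := Fin C.n →₀ RUV

/-- The differential of a pre-complex, as an `R`-linear map. -/
def dmap (C : PreCx) : Msub C →ₗ[RUV] Msub C :=
  Finsupp.linearCombination RUV fun i => ∑ j, Finsupp.single j (C.dm i j)

/-- The submodule `U·C ⊆ C`; `C/U` is the quotient by this submodule. -/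
def uSub (C : PreCx) : Submodule RUV (Msub C) :=
  LinearMap.range (LinearMap.lsmul RUV (Msub C) Uv)

/-- The submodule `V·C ⊆ C`; `C/V` is the quotient by this submodule. -/
def vSub (C : PreCx) : Submodule RUV (Msub C) :=
  LinearMap.range (LinearMap.lsmul RUV (Msub C) Vv)

/-- Chains which die in the homology of `C/U`: the preimage in `C` of the boundaries of
the induced differential on `C/U`. -/
def bdryU (C : PreCx) : Submodule RUV (Msub C) := uSub C ⊔ LinearMap.range (dmap C)

/-- Chains which die in the homology of `C/V`. -/
def bdryV (C : PreCx) : Submodule RUV (Msub C) := vSub C ⊔ LinearMap.range (dmap C)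

/-- A chain `x ∈ C` is homogeneous of bidegree `(p, q)`. -/
def ChainHomog (C : PreCx) (x : Msub C) (p q : ℤ) : Prop :=
  ∀ j, IsHomog (x j) (p - (C.gr j).1) (q - (C.gr j).2)

/-- `x` is a `V`-tower class generator: its class in `H_*(C/U)` is a `V`-nontorsion cycle
whose image generates `H_*(C/U)/(V-torsion)` (equivalently, it is maximally `V`-graded
among `V`-nontorsion classes). -/
def IsVTowerGen (C : PreCx) (x : Msub C) : Prop :=
  dmap C x ∈ uSub C ∧ (∀ k : ℕ, Vv ^ k • x ∉ bdryU C) ∧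
    ∀ z : Msub C, dmap C z ∈ uSub C →
      ∃ (r : RUV) (k : ℕ), Vv ^ k • (z - r • x) ∈ bdryU C

/-- `x` is a `U`-tower class generator: its class in `H_*(C/V)` is a `U`-nontorsion cycle
whose image generates `H_*(C/V)/(U-torsion)`. -/
def IsUTowerGen (C : PreCx) (x : Msub C) : Prop :=
  dmap C x ∈ vSub C ∧ (∀ k : ℕ, Uv ^ k • x ∉ bdryV C) ∧
    ∀ z : Msub C, dmap C z ∈ vSub C →
      ∃ (r : RUV) (k : ℕ), Uv ^ k • (z - r • x) ∈ bdryV C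

/-- `C` is a chain complex over `R` whose differential has degree `(-1, -1)`. -/
def IsCplx (C : PreCx) : Prop :=
  (∀ x, dmap C (dmap C x) = 0) ∧
    ∀ i j, IsHomog (C.dm i j) ((C.gr i).1 - 1 - (C.gr j).1) ((C.gr i).2 - 1 - (C.gr j).2)

/-- A knot-like complex: a free, finitely generated, bigraded chain complex over `R`
whose differential has degree `(-1,-1)`, such that `H_*(C/U)/(V`-torsion`) ≅ 𝔽₂[V]` with
all `V`-nontorsion elements of `H_*(C/U)` in `U`-grading `0`, and
`H_*(C/V)/(U`-torsion`) ≅ 𝔽₂[U]` with all `U`-nontorsion elements of `H_*(C/V)` in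
`V`-grading `0`. -/
structure IsKnotLike (C : PreCx) : Prop where
  dsq : ∀ x, dmap C (dmap C x) = 0
  dhomog : ∀ i j, IsHomog (C.dm i j)
    ((C.gr i).1 - 1 - (C.gr j).1) ((C.gr i).2 - 1 - (C.gr j).2)
  vTowerExists : ∃ x, IsVTowerGen C x
  vTowerGr : ∀ x p q, ChainHomog C x p q → dmap C x ∈ uSub C →
    (∀ k : ℕ, Vv ^ k • x ∉ bdryU C) → p = 0
  uTowerExists : ∃ x, IsUTowerGen C x
  uTowerGr : ∀ x p q, ChainHomog C x p q → dmap C x ∈ vSub C →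
    (∀ k : ℕ, Uv ^ k • x ∉ bdryV C) → q = 0

/-- A module map `f : C₁ → C₂` is homogeneous of bidegree `(s, t)`. -/
def MapHomogShift (C₁ C₂ : PreCx) (f : Msub C₁ →ₗ[RUV] Msub C₂) (s t : ℤ) : Prop :=
  ∀ i j, IsHomog (f (Finsupp.single i 1) j)
    ((C₁.gr i).1 + s - (C₂.gr j).1) ((C₁.gr i).2 + t - (C₂.gr j).2)

/-- A local map `f : C₁ → C₂`: an absolutely `U`-graded, relatively `V`-graded,
`R`-equivariant chain map inducing an isomorphism on `H_*(·/U)/(V-torsion)`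
(equivalently, taking `V`-tower generators to `V`-tower generators). -/
structure IsLocalMap (C₁ C₂ : PreCx) (f : Msub C₁ →ₗ[RUV] Msub C₂) : Prop where
  chain : ∀ x, f (dmap C₁ x) = dmap C₂ (f x)
  graded : ∃ s : ℤ, MapHomogShift C₁ C₂ f 0 s
  towers : ∀ x, IsVTowerGen C₁ x → IsVTowerGen C₂ (f x)

/-- `C₁ ≤ C₂`: there exists a local map `C₁ → C₂`. -/
def LocalLE (C₁ C₂ : PreCx) : Prop := ∃ f, IsLocalMap C₁ C₂ f

/-- Local equivalence of complexes: local maps in both directions. -/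
def LocalEquiv (C₁ C₂ : PreCx) : Prop := LocalLE C₁ C₂ ∧ LocalLE C₂ C₁

/-- `C` is reduced: `∂ ≡ 0 mod (U, V)`. -/
def Reduced (C : PreCx) : Prop := ∀ i j, C.dm i j ∈ Ideal.span ({Uv, Vv} : Set RUV)

/-! ### Standard complexes -/

/-- The shift in bigrading from `x_k` to `x_{k+1}` in a standard complex, where the
parameter joining them is `b` (`k` is the 0-based index of the parameter, so the
parameter is a `U`-power arrow if `k` is even and a `V`-power arrow if `k` is odd). -/
def stepShift (k : ℕ) (b : ℤ) : ℤ × ℤ :=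
  if k % 2 = 0 then
    if b < 0 then (2 * (b.natAbs : ℤ) - 1, -1) else (1 - 2 * (b.natAbs : ℤ), 1)
  else
    if b < 0 then (-1, 2 * (b.natAbs : ℤ) - 1) else (1, 1 - 2 * (b.natAbs : ℤ))

/-- Bigrading of `x_i` relative to `x_0` in the standard complex with parameters `L`. -/
def grRel (L : List ℤ) (i : ℕ) : ℤ × ℤ :=
  ∑ k ∈ Finset.range i, stepShift k (L.getD k 0)

/-- The bigrading of the standard complex of parameters `L`, normalized so that
`gr_U(x_0) = 0` and `gr_V(x_n) = 0`. -/
def stdGr (L : List ℤ) (i : Fin (L.length + 1)) : ℤ × ℤ :=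
  ((grRel L (i : ℕ)).1, (grRel L (i : ℕ)).2 - (grRel L L.length).2)

/-- The differential matrix of the standard complex of parameters `L = (b_1, …, b_n)`:
for `i` odd (1-based), `∂_U x_{i-1} = U^{|b_i|} x_i` if `b_i < 0` and
`∂_U x_i = U^{b_i} x_{i-1}` if `b_i > 0`; for `i` even the same with `V` in place of `U`;
all other differentials vanish. -/
def stdDm (L : List ℤ) (i j : Fin (L.length + 1)) : RUV :=
  if (j : ℕ) = (i : ℕ) + 1 ∧ L.getD (i : ℕ) 0 < 0 then
    (if (i : ℕ) % 2 = 0 then Uv else Vv) ^ (L.getD (i : ℕ) 0).natAbs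
  else if (i : ℕ) = (j : ℕ) + 1 ∧ 0 < L.getD (j : ℕ) 0 then
    (if (j : ℕ) % 2 = 0 then Uv else Vv) ^ (L.getD (j : ℕ) 0).natAbs
  else 0

/-- The standard complex `C(b_1, …, b_n)` of a list of parameters `L = (b_1, …, b_n)`,
with generators `x_0, …, x_n`.  (For `L = []` this is the trivial complex `R`.) -/
def StdCx (L : List ℤ) : PreCx := ⟨L.length + 1, stdGr L, stdDm L⟩

/-- `L` is a valid parameter sequence for a standard complex: all entries are nonzero
and the length is even (possibly zero). -/
def IsStdSeq (L : List ℤ) : Prop := (∀ b ∈ L, b ≠ 0) ∧ Even L.length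

/-- The trivial standard complex `C(0) = R`. -/
def trivCx : PreCx := StdCx []

/-- The bigrading of the semistandard complex `C'(b_1, …, b_n)` (`n` odd), inherited from
the ambient standard complex `C(b_1, …, b_n, 1)`. -/
def semiGr (L : List ℤ) (i : Fin (L.length + 1)) : ℤ × ℤ :=
  ((grRel L (i : ℕ)).1, (grRel L (i : ℕ)).2 - (grRel L L.length).2 + 1)

/-- The semistandard complex `C'(b_1, …, b_n)` (`n` odd): the subcomplex of
`C(b_1, …, b_n, 1)` generated by `x_0, …, x_n`. -/
def SemiStdCx (L : List ℤ) : PreCx := ⟨L.length + 1, semiGr L, stdDm L⟩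

/-! ### Tensor products, duals, direct sums -/

/-- The tensor product (over `R`) of two pre-complexes, with basis `x_i ⊗ y_j` and
differential `∂(x ⊗ y) = ∂x ⊗ y + x ⊗ ∂y` (signs are irrelevant in characteristic 2). -/
def tensorCx (C₁ C₂ : PreCx) : PreCx where
  n := C₁.n * C₂.n
  gr := fun p => C₁.gr (finProdFinEquiv.symm p).1 + C₂.gr (finProdFinEquiv.symm p).2
  dm := fun p q =>
    (if (finProdFinEquiv.symm p).2 = (finProdFinEquiv.symm q).2 then
      C₁.dm (finProdFinEquiv.symm p).1 (finProdFinEquiv.symm q).1 else 0) +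
    (if (finProdFinEquiv.symm p).1 = (finProdFinEquiv.symm q).1 then
      C₂.dm (finProdFinEquiv.symm p).2 (finProdFinEquiv.symm q).2 else 0)

/-- The dual complex `C^∨ = Hom_R(C, R)`, described on the dual basis: the gradings are
negated and the differential matrix is transposed. -/
def dualCx (C : PreCx) : PreCx := ⟨C.n, fun i => -C.gr i, fun i j => C.dm j i⟩

/-- The direct sum of two pre-complexes. -/
def sumCx (C₁ C₂ : PreCx) : PreCx where
  n := C₁.n + C₂.n
  gr := fun p => Sum.elim C₁.gr C₂.gr (finSumFinEquiv.symm p)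
  dm := fun p q =>
    match finSumFinEquiv.symm p, finSumFinEquiv.symm q with
    | Sum.inl i, Sum.inl k => C₁.dm i k
    | Sum.inr j, Sum.inr l => C₂.dm j l
    | _, _ => 0

/-- A homotopy equivalence of bigraded chain complexes over `R`: chain maps `f, g`
preserving the bigrading, with `g ∘ f ≃ id` and `f ∘ g ≃ id` via `R`-equivariant
homotopies of bidegree `(1, 1)`. -/
def HomotopyEquivCx (C₁ C₂ : PreCx) : Prop :=
  ∃ (f : Msub C₁ →ₗ[RUV] Msub C₂) (g : Msub C₂ →ₗ[RUV] Msub C₁)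
    (H : Msub C₁ →ₗ[RUV] Msub C₁) (K : Msub C₂ →ₗ[RUV] Msub C₂),
    (∀ x, f (dmap C₁ x) = dmap C₂ (f x)) ∧
    (∀ y, g (dmap C₂ y) = dmap C₁ (g y)) ∧
    MapHomogShift C₁ C₂ f 0 0 ∧ MapHomogShift C₂ C₁ g 0 0 ∧
    MapHomogShift C₁ C₁ H 1 1 ∧ MapHomogShift C₂ C₂ K 1 1 ∧
    (∀ x, g (f x) - x = dmap C₁ (H x) + H (dmap C₁ x)) ∧
    (∀ y, f (g y) - y = dmap C₂ (K y) + K (dmap C₂ y))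

/-- An isomorphism of bigraded chain complexes over `R`. -/
def IsBigradedChainIso (C₁ C₂ : PreCx) (f : Msub C₁ →ₗ[RUV] Msub C₂) : Prop :=
  Function.Bijective f ∧ (∀ x, f (dmap C₁ x) = dmap C₂ (f x)) ∧ MapHomogShift C₁ C₂ f 0 0

/-! ### Short maps -/

/-- A short map `f : C(b_1, …, b_n) ⇝ C`: an absolutely `U`-graded, relatively
`V`-graded `R`-module map which is a chain map at `x_1, …, x_{n-1}` and commutes with
the `V`-part of the differential at `x_n` (for reduced `C`, the failure
`∂ f(x_n) - f(∂_V x_n)` is exactly `∂_U f(x_n) ∈ U·C`). -/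
def IsShortMap (L : List ℤ) (C : PreCx) (f : Msub (StdCx L) →ₗ[RUV] Msub C) : Prop :=
  (∃ s : ℤ, MapHomogShift (StdCx L) C f 0 s) ∧
  (∀ i : Fin (L.length + 1), 1 ≤ (i : ℕ) → (i : ℕ) + 1 ≤ L.length →
    f (dmap (StdCx L) (Finsupp.single i 1)) = dmap C (f (Finsupp.single i 1))) ∧
  dmap C (f (Finsupp.single (Fin.last L.length) 1)) -
    f (dmap (StdCx L) (Finsupp.single (Fin.last L.length) 1)) ∈ uSub C

/-- A short local map: a short map sending the `V`-tower generator `x_0` to a `V`-tower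
generator (hence inducing an isomorphism on `H_*(·/U)/(V-torsion)`). -/
def IsShortLocalMap (L : List ℤ) (C : PreCx) (f : Msub (StdCx L) →ₗ[RUV] Msub C) : Prop :=
  IsShortMap L C f ∧ IsVTowerGen C (f (Finsupp.single (0 : Fin (L.length + 1)) 1))

/-- A local map from the semistandard complex `C'(b_1, …, b_n)` to a knot-like complex:
a grading-preserving `R`-equivariant chain map under which the class of `x_0`
generates `H_*(C/U)/(V-torsion)`. -/
def IsSemiLocalMap (L : List ℤ) (C : PreCx) (f : Msub (SemiStdCx L) →ₗ[RUV] Msub C) : Prop :=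
  (∀ x, f (dmap (SemiStdCx L) x) = dmap C (f x)) ∧
  MapHomogShift (SemiStdCx L) C f 0 0 ∧
  IsVTowerGen C (f (Finsupp.single (0 : Fin (L.length + 1)) 1))

/-! ### The order `Z^!` and the numerical invariants -/

/-- The embedding of `Z^!` into `ℚ` realizing the order
`-1 <^! -2 <^! ⋯ <^! 0 <^! ⋯ <^! 2 <^! 1`: send `0 ↦ 0` and `a ↦ 1/a` otherwise. -/
def qval (a : ℤ) : ℚ := if a = 0 then 0 else 1 / (a : ℚ)

/-- The order `≤^!` on `Z^!`. -/
def bangLE (a b : ℤ) : Prop := qval a ≤ qval b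

/-- Pad a finite sequence with trailing zeros. -/
def seqPad (L : List ℤ) (i : ℕ) : ℤ := L.getD i 0

/-- The lexicographic order on finite integer sequences induced by `≤^!`, padding the
shorter sequence with trailing zeros. -/
def bangLexLE (L₁ L₂ : List ℤ) : Prop :=
  (∀ i, seqPad L₁ i = seqPad L₂ i) ∨
    ∃ k, (∀ i < k, seqPad L₁ i = seqPad L₂ i) ∧ qval (seqPad L₁ k) < qval (seqPad L₂ k)

/-- `m` is an upper bound for `S ⊆ Z^!` with respect to `≤^!`. -/
def IsBangUB (S : Set ℤ) (m : ℤ) : Prop := ∀ b ∈ S, qval b ≤ qval m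

/-- `m = sup^! S`, the least upper bound of `S ⊆ Z^!` with respect to `≤^!`. -/
def IsBangLUB (S : Set ℤ) (m : ℤ) : Prop :=
  IsBangUB S m ∧ ∀ m' : ℤ, IsBangUB S m' → qval m ≤ qval m'

/-- Candidate set for the next invariant: given the already-constructed prefix `P`,
those nonzero `b` such that some standard complex `C(P, b, rest) ≤ C`. -/
def candSet (C : PreCx) (P : List ℤ) : Set ℤ :=
  {b | b ≠ 0 ∧ ∃ rest : List ℤ, IsStdSeq (P ++ b :: rest) ∧ LocalLE (StdCx (P ++ b :: rest)) C}

/-- `a` is the sequence of numerical invariants `a_i(C)` (indexed from `0`):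
once a term vanishes all later terms vanish, and otherwise each term is
`sup^!` of the corresponding candidate set. -/
def InvSeq (C : PreCx) (a : ℕ → ℤ) : Prop :=
  ∀ k : ℕ,
    ((∃ i < k, a i = 0) → a k = 0) ∧
    ((∀ i < k, a i ≠ 0) → IsBangLUB (candSet C ((List.range k).map a)) (a k))

/-- The first `n` terms of `a`, with the (all-zero) tail deleted. -/
def truncSeq (a : ℕ → ℤ) (n : ℕ) : List ℤ :=
  ((List.range n).map a).takeWhile (fun b => b != 0)

/-! ### The homomorphisms `φ_j`, `P` and the shifts `sh_m` -/

/-- `φ_j` of a standard complex `C(a_1, …, a_n)`: the signed count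
`#{i odd : a_i = j} − #{i odd : a_i = −j}` (with 1-based odd `i`). -/
def phi (j : ℕ) (L : List ℤ) : ℤ :=
  ∑ i ∈ Finset.range L.length,
    if i % 2 = 0 then
      (if L.getD i 0 = (j : ℤ) then 1 else 0) - (if L.getD i 0 = -(j : ℤ) then 1 else 0)
    else 0

/-- The shift `sh_m` on parameter sequences: entries of absolute value `≥ m` are pushed
one further from zero; entries of absolute value `< m` are fixed. -/
def shSeq (m : ℕ) (L : List ℤ) : List ℤ :=
  L.map fun a => if (m : ℤ) ≤ a then a + 1 else if a ≤ -(m : ℤ) then a - 1 else a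

/-- `P(C) = -2 ∑_{j>0} j φ_j(C) + ∑_i sgn a_i`, computed from the parameter sequence of
the standard representative (the sum over `j` is finite since `φ_j` vanishes for
`j` larger than any `|a_i|`). -/
def Pval (L : List ℤ) : ℤ :=
  -2 * (∑ j ∈ Finset.range ((L.map Int.natAbs).sum + 1), (j : ℤ) * phi j L) +
    (L.map Int.sign).sum

end

open Polynomial in
/-- The quotient map `R → 𝔽₂[X]` sending the `t`-th variable of `(U, V)` to `X` and the other
one to `0`. -/
noncomputable def axisMap (t : Fin 2) : RUV →+* (ZMod 2)[X] :=
  Ideal.Quotient.lift IUV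
    (MvPolynomial.aeval (R := ZMod 2) fun s => if s = t then (X : (ZMod 2)[X]) else 0).toRingHom
    (by
      intro a ha
      obtain ⟨c, rfl⟩ := Ideal.mem_span_singleton.1 ha
      fin_cases t <;> simp)

open Polynomial in
theorem axisMap_Uv (t : Fin 2) : axisMap t Uv = if t = 0 then X else 0 := by
  fin_cases t <;> simp [axisMap, Uv]

open Polynomial in
theorem axisMap_Vv (t : Fin 2) : axisMap t Vv = if t = 1 then X else 0 := by
  fin_cases t <;> simp [axisMap, Vv]

open Polynomial in
theorem mem_span_Uv_of_axisMap_eq_zero {r : RUV} (h : axisMap 1 r = 0) :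
    r ∈ Ideal.span {Uv} := by
  have key : ((Ideal.Quotient.mk (Ideal.span {Uv})).comp
      (((aeval Vv).toRingHom : (ZMod 2)[X] →+* RUV).comp (axisMap 1))) =
      Ideal.Quotient.mk (Ideal.span {Uv}) := by
    apply Ideal.Quotient.ringHom_ext
    apply MvPolynomial.ringHom_ext
    · intro a
      obtain ⟨n, rfl⟩ := ZMod.natCast_zmod_surjective a
      simp
    · intro i
      fin_cases i
      · change Ideal.Quotient.mk _ (aeval Vv (axisMap 1 Uv)) = Ideal.Quotient.mk _ Uv
        rw [axisMap_Uv]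
        simp [Ideal.Quotient.eq_zero_iff_mem.2 (Ideal.mem_span_singleton_self Uv)]
      · change Ideal.Quotient.mk _ (aeval Vv (axisMap 1 Vv)) = Ideal.Quotient.mk _ Vv
        simp [axisMap_Vv]
  have h2 := congrArg (fun g => g r) key
  simp only [RingHom.comp_apply, h, map_zero] at h2
  exact Ideal.Quotient.eq_zero_iff_mem.1 h2.symm

theorem Uv_mul_Vv : Uv * Vv = 0 := by
  rw [Uv, Vv, ← map_mul]
  exact Ideal.Quotient.eq_zero_iff_mem.2 (Ideal.mem_span_singleton_self _)

theorem IsHomog.eq_one {r : RUV} {p q : ℤ} (h : IsHomog r p q) {t : Fin 2}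
    (h0 : (axisMap t r).coeff 0 ≠ 0) : r = 1 := by
  rw [Polynomial.coeff_zero_eq_eval_zero] at h0
  rcases h with rfl | ⟨a, rfl, -, -⟩ | ⟨a, rfl, -, -⟩
  · simp at h0
  · rcases Nat.eq_zero_or_pos a with rfl | ha
    · simp
    · rw [map_pow, axisMap_Uv] at h0
      split_ifs at h0 <;> simp [ha.ne'] at h0
  · rcases Nat.eq_zero_or_pos a with rfl | ha
    · simp
    · rw [map_pow, axisMap_Vv] at h0
      split_ifs at h0 <;> simp [ha.ne'] at h0

theorem IsHomog.eq_one_of_isUnit {r : RUV} {p q : ℤ} (h : IsHomog r p q) (hr : IsUnit r) :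
    r = 1 := by
  refine h.eq_one (t := 0) ?_
  rw [Polynomial.coeff_zero_eq_eval_zero, ← Polynomial.coe_evalRingHom]
  exact ((hr.map (axisMap 0)).map (Polynomial.evalRingHom 0)).ne_zero

theorem isHomog_one_iff {p q : ℤ} : IsHomog 1 p q ↔ p = 0 ∧ q = 0 := by
  constructor
  · rintro (h | ⟨a, h, hp, hq⟩ | ⟨a, h, hp, hq⟩)
    · simpa using congrArg (axisMap 0) h
    · have h2 := congrArg (axisMap 1) h
      rw [map_pow, axisMap_Uv, map_one] at h2
      rcases Nat.eq_zero_or_pos a with rfl | ha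
      · simp_all
      · simp [ha.ne'] at h2
    · have h2 := congrArg (axisMap 0) h
      rw [map_pow, axisMap_Vv, map_one] at h2
      rcases Nat.eq_zero_or_pos a with rfl | ha
      · simp_all
      · simp [ha.ne'] at h2
  · rintro ⟨rfl, rfl⟩
    exact Or.inr (Or.inl ⟨0, by simp⟩)

theorem IsHomog.eq_zero_or_one {r : RUV} (h : IsHomog r 0 0) : r = 0 ∨ r = 1 := by
  rcases h with rfl | ⟨a, rfl, ha, -⟩ | ⟨a, rfl, -, ha⟩
  · simp
  · obtain rfl : a = 0 := by omega
    simp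
  · obtain rfl : a = 0 := by omega
    simp

theorem IsHomog.mul {r s : RUV} {p q p' q' : ℤ} (hr : IsHomog r p q) (hs : IsHomog s p' q') :
    IsHomog (r * s) (p + p') (q + q') := by
  rcases hr with rfl | ⟨a, rfl, rfl, rfl⟩ | ⟨a, rfl, rfl, rfl⟩
  · left; simp
  · rcases hs with rfl | ⟨b, rfl, rfl, rfl⟩ | ⟨b, rfl, rfl, rfl⟩
    · left; simp
    · right; left
      exact ⟨a + b, by rw [pow_add], by push_cast; ring, by ring⟩
    · rcases a with - | a
      · right; right
        exact ⟨b, by simp, by simp, by simp⟩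
      · rcases b with - | b
        · right; left
          exact ⟨a + 1, by simp, by simp, by simp⟩
        · left
          rw [pow_succ, pow_succ', mul_assoc, ← mul_assoc Uv, Uv_mul_Vv]
          simp
  · rcases hs with rfl | ⟨b, rfl, rfl, rfl⟩ | ⟨b, rfl, rfl, rfl⟩
    · left; simp
    · rcases a with - | a
      · right; left
        exact ⟨b, by simp, by simp, by simp⟩
      · rcases b with - | b
        · right; right
          exact ⟨a + 1, by simp, by simp, by simp⟩
        · left
          rw [pow_succ, pow_succ', mul_assoc, ← mul_assoc Vv, mul_comm Vv, Uv_mul_Vv]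
          simp
    · right; right
      exact ⟨a + b, by rw [pow_add], by ring, by push_cast; ring⟩

theorem IsHomog.prod {ι : Type*} (s : Finset ι) {r : ι → RUV} {p q : ι → ℤ}
    (h : ∀ i ∈ s, IsHomog (r i) (p i) (q i)) :
    IsHomog (∏ i ∈ s, r i) (∑ i ∈ s, p i) (∑ i ∈ s, q i) := by
  classical
  induction s using Finset.induction_on with
  | empty => simp [isHomog_one_iff]
  | insert a s ha ih =>
    rw [Finset.prod_insert ha, Finset.sum_insert ha, Finset.sum_insert ha]
    exact (h a (Finset.mem_insert_self a s)).mul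
      (ih fun i hi => h i (Finset.mem_insert_of_mem hi))

/-- In a bigraded square matrix over `R`, a permutation contributes to the determinant only if
all the entries it picks are `1`. -/
theorem prod_eq_zero_of_homog {ι : Type*} [Fintype ι] (M : ι → ι → RUV) (g h : ι → ℤ)
    (hM : ∀ i j, IsHomog (M i j) (g i - g j) (h i - h j)) (σ : Equiv.Perm ι)
    (hσ : ∃ i, M i (σ i) ≠ 1) : ∏ i, M i (σ i) = 0 := by
  have hp := IsHomog.prod Finset.univ fun i _ => hM i (σ i)
  rw [Finset.sum_sub_distrib, Finset.sum_sub_distrib, Equiv.sum_comp σ g, Equiv.sum_comp σ h,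
    sub_self, sub_self] at hp
  refine hp.eq_zero_or_one.resolve_right fun h1 => ?_
  obtain ⟨i, hi⟩ := hσ
  exact hi ((hM i (σ i)).eq_one_of_isUnit
    (isUnit_of_dvd_one (h1 ▸ Finset.dvd_prod_of_mem _ (Finset.mem_univ i))))

theorem qval_injective : Function.Injective qval := by
  intro a b h
  unfold qval at h
  split_ifs at h with h1 h2 h2
  · rw [h1, h2]
  · exact absurd h.symm (by simpa using h2)
  · exact absurd h (by simpa using h1)
  · simpa using h

open Polynomial in
/-- Two polynomials `X ^ a * P = X ^ b * Q` with `P(0) ≠ 0` satisfy `b ≤ a`, and `Q(0) ≠ 0` when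
`a = b`. -/
theorem le_of_X_pow_mul_eq {P Q : (ZMod 2)[X]} {a b : ℕ} (h : X ^ a * P = X ^ b * Q)
    (hP : P.coeff 0 ≠ 0) : b ≤ a ∧ (a = b → Q.coeff 0 ≠ 0) := by
  constructor
  · by_contra! hab
    have := congrArg (fun p => p.coeff a) h
    simp only [coeff_X_pow_mul', le_refl, if_true, Nat.sub_self] at this
    rw [if_neg (by omega)] at this
    exact hP this
  · rintro rfl
    rwa [← mul_left_cancel₀ (pow_ne_zero a X_ne_zero) h]

theorem qval_le_of_neg {a b : ℤ} (ha : a < 0) (hb : b < 0) (h : a.natAbs ≤ b.natAbs) :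
    qval a ≤ qval b := by
  have hab : b ≤ a := by omega
  rw [qval, qval, if_neg ha.ne, if_neg hb.ne]
  exact one_div_le_one_div_of_neg_of_le (by exact_mod_cast ha) (by exact_mod_cast hab)

theorem qval_le_of_pos {a b : ℤ} (hb : 0 < b) (h : b.natAbs ≤ a.natAbs) (ha : 0 < a) :
    qval a ≤ qval b := by
  have hab : b ≤ a := by omega
  rw [qval, qval, if_neg ha.ne', if_neg hb.ne']
  exact one_div_le_one_div_of_le (by exact_mod_cast hb) (by exact_mod_cast hab)

theorem qval_nonneg {a : ℤ} (ha : 0 ≤ a) : 0 ≤ qval a := by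
  unfold qval
  split_ifs
  · rfl
  · have : (0 : ℚ) ≤ a := by exact_mod_cast ha
    positivity

theorem qval_nonpos {a : ℤ} (ha : a ≤ 0) : qval a ≤ 0 := by
  unfold qval
  split_ifs
  · rfl
  · have : (a : ℚ) ≤ 0 := by exact_mod_cast ha
    exact one_div_nonpos.2 this

open Polynomial in
/-- A matching differential on a set of generators: the generator `i` is joined to `ν i` by an
arrow of length `|e i|`, outgoing from `i` if `e i < 0` and incoming if `e i > 0`. If the matrix
`N` commutes with it, then `N` moves generators upwards in the `≤^!` order, and nonzero constant
coefficients propagate along arrows of equal lengths. -/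
theorem qval_le_of_commute {ι : Type*} [Fintype ι] [DecidableEq ι] {ν : ι → ι} {e : ι → ℤ}
    (hν : ∀ i, ν (ν i) = i) (he : ∀ i, e (ν i) = -e i) (hfix : ∀ i, e i = 0 → ν i = i)
    {D N : ι → ι → (ZMod 2)[X]}
    (hD : ∀ i j, D i j = if j = ν i ∧ e i < 0 then X ^ (e i).natAbs else 0)
    (hDN : ∀ i k, ∑ j, D i j * N j k = ∑ j, N i j * D j k)
    {p q : ι} (hpq : (N p q).coeff 0 ≠ 0) :
    qval (e p) ≤ qval (e q) ∧ (e p = e q → (N (ν p) (ν q)).coeff 0 ≠ 0) := by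
  have key : ∀ i k, (if e i < 0 then X ^ (e i).natAbs * N (ν i) k else 0) =
      if 0 < e k then X ^ (e k).natAbs * N i (ν k) else 0 := by
    intro i k
    have h := hDN i k
    rw [Finset.sum_eq_single (ν i) (fun j _ hj => by simp [hD, hj]) (by simp),
      Finset.sum_eq_single (ν k) (fun j _ hj => by
        have : k ≠ ν j := fun h => hj (by rw [h, hν])
        simp [hD, this]) (by simp)] at h
    simp only [hD, hν, true_and, he, Int.natAbs_neg, Left.neg_neg_iff] at h
    rw [mul_comm (N i (ν k))] at h
    simpa only [ite_mul, zero_mul] using h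
  have hN : ∀ a : ℕ, X ^ a * N p q ≠ 0 := fun a =>
    mul_ne_zero (pow_ne_zero a X_ne_zero) (by rintro h; simp [h] at hpq)
  rcases lt_or_ge 0 (e p) with hp | hp
  · have h := key (ν p) q
    rw [he, hν, if_pos (by omega), Int.natAbs_neg] at h
    split_ifs at h with hq
    · obtain ⟨h1, h2⟩ := le_of_X_pow_mul_eq h hpq
      exact ⟨qval_le_of_pos hq h1 hp, fun h3 => h2 (by rw [h3])⟩
    · exact absurd h (hN _)
  · rcases lt_or_ge (e q) 0 with hq | hq
    · have h := key p (ν q)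
      rw [he, hν, if_pos (c := 0 < _) (by omega), Int.natAbs_neg] at h
      split_ifs at h with hp'
      · obtain ⟨h1, h2⟩ := le_of_X_pow_mul_eq h.symm hpq
        exact ⟨qval_le_of_neg hp' hq h1, fun h3 => h2 (by rw [h3])⟩
      · exact absurd h.symm (hN _)
    · refine ⟨(qval_nonpos hp).trans (qval_nonneg hq), fun h => ?_⟩
      rwa [hfix p (by omega), hfix q (by omega)]

theorem dmap_single (C : PreCx) (i : Fin C.n) (r : RUV) (j : Fin C.n) :
    dmap C (Finsupp.single i r) j = r * C.dm i j := by
  simp [dmap, Finsupp.single_apply]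

theorem dmap_apply (C : PreCx) (x : Msub C) (j : Fin C.n) :
    dmap C x j = ∑ i, x i * C.dm i j := by
  conv_lhs => rw [← Finsupp.univ_sum_single x]
  rw [map_sum, Finsupp.finsetSum_apply]
  exact Finset.sum_congr rfl fun i _ => dmap_single C i (x i) j

theorem map_apply_eq_sum {m n : ℕ} (f : (Fin m →₀ RUV) →ₗ[RUV] (Fin n →₀ RUV))
    (x : Fin m →₀ RUV) (k : Fin n) : f x k = ∑ j, x j * f (Finsupp.single j 1) k := by
  conv_lhs => rw [← Finsupp.univ_sum_single x]
  rw [map_sum, Finsupp.finsetSum_apply]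
  refine Finset.sum_congr rfl fun j _ => ?_
  rw [← mul_one (x j), ← smul_eq_mul, ← Finsupp.smul_single, map_smul]
  simp

theorem mem_uSub_of_forall {C : PreCx} {x : Msub C} (h : ∀ j, axisMap 1 (x j) = 0) :
    x ∈ uSub C := by
  rw [← Finsupp.univ_sum_single x]
  refine Submodule.sum_mem _ fun j _ => ?_
  obtain ⟨c, hc⟩ := Ideal.mem_span_singleton.1 (mem_span_Uv_of_axisMap_eq_zero (h j))
  exact ⟨Finsupp.single j c, by simp [hc]⟩

theorem axisMap_apply_of_mem_uSub {C : PreCx} {x : Msub C} (h : x ∈ uSub C) (j : Fin C.n) :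
    axisMap 1 (x j) = 0 := by
  obtain ⟨y, rfl⟩ := h
  simp [axisMap_Uv]

open Polynomial in
/-- The generators of `C` are joined by arrows of two types `t` (`U` for `0`, `V` for `1`): `x_p`
is joined to `x_{ν t p}` by an arrow of length `|e t p|`, outgoing from `x_p` if `e t p < 0` and
incoming if `e t p > 0`, and these arrows give the differential. The arrows connect all the
generators, and `z` is the only one without a `V`-arrow. -/
structure IsMatched (C : PreCx) (ν : Fin 2 → Fin C.n → Fin C.n) (e : Fin 2 → Fin C.n → ℤ)
    (z : Fin C.n) : Prop where
  nbr_nbr : ∀ t p, ν t (ν t p) = p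
  len_nbr : ∀ t p, e t (ν t p) = -e t p
  nbr_eq_self : ∀ t p, e t p = 0 → ν t p = p
  len_eq_zero_iff : ∀ p, e 1 p = 0 ↔ p = z
  axisMap_dm : ∀ t i j, axisMap t (C.dm i j) =
    if j = ν t i ∧ e t i < 0 then X ^ (e t i).natAbs else 0
  connected : ∀ P : Fin C.n → Prop, P z → (∀ t p, P p → P (ν t p)) → ∀ p, P p

namespace IsMatched

variable {C : PreCx} {ν : Fin 2 → Fin C.n → Fin C.n} {e : Fin 2 → Fin C.n → ℤ} {z : Fin C.n}

theorem axisMap_dmap_apply (hC : IsMatched C ν e z) (t : Fin 2) (x : Msub C) (i : Fin C.n) :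
    axisMap t (dmap C x (ν t i)) = if e t i < 0 then
      axisMap t (x i) * Polynomial.X ^ (e t i).natAbs else 0 := by
  rw [dmap_apply, map_sum, Finset.sum_eq_single i]
  · rw [map_mul, hC.axisMap_dm]
    simp
  · intro j _ hj
    have : ν t i ≠ ν t j := fun h => hj (by rw [← hC.nbr_nbr t i, h, hC.nbr_nbr])
    rw [map_mul, hC.axisMap_dm, if_neg fun h => this h.1, mul_zero]
  · simp

theorem axisMap_apply_of_mem_bdryU (hC : IsMatched C ν e z) {x : Msub C} (h : x ∈ bdryU C) :
    axisMap 1 (x z) = 0 := by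
  obtain ⟨y, hy, _, ⟨w, rfl⟩, rfl⟩ := Submodule.mem_sup.1 h
  have hz := (hC.len_eq_zero_iff z).2 rfl
  have h1 := hC.axisMap_dmap_apply 1 w z
  rw [hC.nbr_eq_self 1 z hz, hz] at h1
  rw [Finsupp.add_apply, map_add, axisMap_apply_of_mem_uSub hy, h1]
  simp

theorem isVTowerGen_single (hC : IsMatched C ν e z) : IsVTowerGen C (Finsupp.single z 1) := by
  have hz := (hC.len_eq_zero_iff z).2 rfl
  refine ⟨mem_uSub_of_forall fun j => ?_, fun k hk => ?_, fun y hy => ?_⟩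
  · rw [dmap_single, one_mul, hC.axisMap_dm, hz]
    simp
  · simpa [axisMap_Vv] using hC.axisMap_apply_of_mem_bdryU hk
  · obtain ⟨K, hK⟩ : ∃ K : ℕ, ∀ i, (e 1 i).natAbs ≤ K :=
      ⟨∑ i, (e 1 i).natAbs, fun i =>
        Finset.single_le_sum (f := fun i => (e 1 i).natAbs) (fun _ _ => Nat.zero_le _)
          (Finset.mem_univ i)⟩
    refine ⟨y z, K, ?_⟩
    set w : Msub C := y - y z • (Finsupp.single z 1 : Msub C) with hw
    have hwi : ∀ i, i ≠ z → w i = y i := by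
      intro i hi
      simp [hw, hi.symm]
    rw [← Finsupp.univ_sum_single w, Finset.smul_sum]
    refine Submodule.sum_mem _ fun i _ => ?_
    rcases lt_trichotomy (e 1 i) 0 with h | h | h
    · refine Submodule.smul_mem _ _ (Submodule.mem_sup_left (mem_uSub_of_forall fun j => ?_))
      have h1 := hC.axisMap_dmap_apply 1 y i
      rw [axisMap_apply_of_mem_uSub hy, if_pos h] at h1
      have h2 : axisMap 1 (y i) = 0 :=
        (mul_eq_zero.1 h1.symm).resolve_right (pow_ne_zero _ Polynomial.X_ne_zero)
      rw [hwi i (by rintro rfl; omega), Finsupp.single_apply]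
      split_ifs
      · exact h2
      · simp
    · obtain rfl := (hC.len_eq_zero_iff i).1 h
      simp [hw]
    · have hb : Vv ^ (e 1 i).natAbs • (Finsupp.single i 1 : Msub C) ∈ bdryU C := by
        rw [← sub_add_cancel (Vv ^ (e 1 i).natAbs • (Finsupp.single i 1 : Msub C))
          (dmap C (Finsupp.single (ν 1 i) 1))]
        refine Submodule.add_mem_sup (mem_uSub_of_forall fun j => ?_) ⟨_, rfl⟩
        rw [Finsupp.sub_apply, dmap_single, one_mul, map_sub, hC.axisMap_dm, hC.nbr_nbr,
          hC.len_nbr]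
        simp [h, Finsupp.single_apply, axisMap_Vv, apply_ite (axisMap 1), eq_comm]
      have h2 : Vv ^ K • (Finsupp.single i (w i) : Msub C) =
          (w i * Vv ^ (K - (e 1 i).natAbs)) • Vv ^ (e 1 i).natAbs •
            (Finsupp.single i 1 : Msub C) := by
        rw [smul_smul, mul_assoc, ← pow_add, Nat.sub_add_cancel (hK i), Finsupp.smul_single,
          Finsupp.smul_single, smul_eq_mul, smul_eq_mul, mul_one, mul_comm]
      rw [h2]
      exact Submodule.smul_mem _ _ hb

/-- If a relation increases the lengths of the arrows in the `≤^!` order, and propagates along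
arrows of equal lengths, then it contains the graph of no permutation but the identity. -/
theorem perm_eq_one (hC : IsMatched C ν e z) (S : Fin C.n → Fin C.n → Prop)
    (hle : ∀ t p q, S p q → qval (e t p) ≤ qval (e t q))
    (hS : ∀ t p q, S p q → e t p = e t q → S (ν t p) (ν t q))
    (σ : Equiv.Perm (Fin C.n)) (hσ : ∀ p, S p (σ p)) : σ = 1 := by
  have hlen : ∀ σ : Equiv.Perm (Fin C.n), (∀ p, S p (σ p)) → ∀ t p, e t p = e t (σ p) := by
    intro σ hσ t p
    have hsum : ∑ p, qval (e t p) = ∑ p, qval (e t (σ p)) :=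
      (Equiv.sum_comp σ fun p => qval (e t p)).symm
    exact qval_injective ((Finset.sum_eq_sum_iff_of_le fun p _ => hle t p _ (hσ p)).1 hsum p
      (Finset.mem_univ p))
  have main : ∀ p, ∀ σ : Equiv.Perm (Fin C.n), (∀ p, S p (σ p)) → σ p = p := by
    refine hC.connected _ (fun σ hσ => ?_) fun t p ih σ hσ => ?_
    · rw [← hC.len_eq_zero_iff, ← hlen σ hσ, hC.len_eq_zero_iff]
    · let τ : Equiv.Perm (Fin C.n) := ⟨ν t, ν t, hC.nbr_nbr t, hC.nbr_nbr t⟩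
      have h1 : ν t (σ (ν t p)) = p := ih (τ * σ * τ) fun q => by
        have h2 := hS t _ _ (hσ (ν t q)) (hlen σ hσ t _)
        rwa [hC.nbr_nbr] at h2
      rw [← hC.nbr_nbr t (σ (ν t p)), h1]
  exact Equiv.ext fun p => main p σ hσ

/-- A local self-map has coefficient `1` at the tower generator, and preserves the bigrading. -/
theorem localMap_apply (hC : IsMatched C ν e z) {f : Msub C →ₗ[RUV] Msub C}
    (hf : IsLocalMap C C f) :
    f (Finsupp.single z 1) z = 1 ∧ MapHomogShift C C f 0 0 := by
  obtain ⟨s, hs⟩ := hf.graded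
  have hx := hC.isVTowerGen_single
  obtain ⟨r, k, hrk⟩ := (hf.towers _ hx).2.2 _ hx.1
  have h1 := hC.axisMap_apply_of_mem_bdryU hrk
  set c := f (Finsupp.single z 1) z with hc
  have h2 : axisMap 1 r * axisMap 1 c = 1 := by
    have h3 : (Polynomial.X : Polynomial (ZMod 2)) ^ k * (1 - axisMap 1 r * axisMap 1 c) = 0 := by
      simpa [axisMap_Vv, ← hc] using h1
    exact (sub_eq_zero.1
      ((mul_eq_zero.1 h3).resolve_left (pow_ne_zero _ Polynomial.X_ne_zero))).symm
  have hcs : IsHomog c _ _ := hs z z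
  have hc1 : c = 1 := by
    refine hcs.eq_one (t := 1) fun h => ?_
    have h3 := congrArg (fun p => p.coeff 0) h2
    simp [Polynomial.mul_coeff_zero, h] at h3
  refine ⟨hc1, ?_⟩
  rw [hc1, isHomog_one_iff] at hcs
  obtain rfl : s = 0 := by linarith [hcs.2]
  exact hs

theorem bijective_of_isLocalMap (hC : IsMatched C ν e z) {f : Msub C →ₗ[RUV] Msub C}
    (hf : IsLocalMap C C f) : Function.Bijective f := by
  obtain ⟨hz, hgr⟩ := hC.localMap_apply hf
  let M : Fin C.n → Fin C.n → RUV := fun i j => f (Finsupp.single i 1) j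
  have hM : ∀ i j, IsHomog (M i j) ((C.gr i).1 - (C.gr j).1) ((C.gr i).2 - (C.gr j).2) :=
    fun i j => by simpa only [add_zero] using hgr i j
  have hchain : ∀ i k, ∑ j, C.dm i j * M j k = ∑ j, M i j * C.dm j k := by
    intro i k
    have h := DFunLike.congr_fun (hf.chain (Finsupp.single i 1)) k
    rw [dmap_apply, map_apply_eq_sum] at h
    simpa only [dmap_single, one_mul] using h
  have hstep : ∀ t p q, M p q = 1 → qval (e t p) ≤ qval (e t q) ∧
      (e t p = e t q → M (ν t p) (ν t q) = 1) := by
    intro t p q hpq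
    have h := qval_le_of_commute (hC.nbr_nbr t) (hC.len_nbr t) (hC.nbr_eq_self t)
      (D := fun i j => axisMap t (C.dm i j)) (N := fun i j => axisMap t (M i j))
      (hC.axisMap_dm t)
      (fun i k => by simpa only [map_sum, map_mul] using congrArg (axisMap t) (hchain i k))
      (p := p) (q := q) (by simp [hpq])
    exact ⟨h.1, fun h' => (hM _ _).eq_one (h.2 h')⟩
  have hdiag : ∀ p, M p p = 1 :=
    hC.connected _ hz fun t p hp => (hstep t p p hp).2 rfl
  let b : Module.Basis (Fin C.n) RUV (Msub C) := Finsupp.basisSingleOne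
  have hb : ∀ i j, LinearMap.toMatrix b b f j i = M i j := by
    simp [b, M, LinearMap.toMatrix_apply]
  have hdet : (LinearMap.toMatrix b b f).det = 1 := by
    rw [Matrix.det_apply, Finset.sum_eq_single 1]
    · simp [hb, hdiag]
    · intro σ _ hσ
      simp only [hb]
      rw [prod_eq_zero_of_homog M _ _ hM σ, smul_zero]
      by_contra! h
      exact hσ (hC.perm_eq_one (fun p q => M p q = 1)
        (fun t p q h => (hstep t p q h).1) (fun t p q h => (hstep t p q h).2) σ h)
    · simp
  exact (LinearEquiv.ofIsUnitDet (f := f) (v := b) (v' := b) (by simp [hdet])).bijective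

end IsMatched

/-- The signed length of the arrow of type `t` (`U` for `0`, `V` for `1`) at the generator `x_p`
of a standard complex: negative if it is outgoing, `0` if there is none. -/
def arrowLen (L : List ℤ) (t : Fin 2) (p : Fin (L.length + 1)) : ℤ :=
  if (p : ℕ) % 2 = t then L.getD p 0 else if (p : ℕ) = 0 then 0 else -L.getD (p - 1) 0

/-- The generator joined to `x_p` by an arrow of type `t` in a standard complex (`x_p` itself if
there is none). -/
def arrowNbr (L : List ℤ) (t : Fin 2) (p : Fin (L.length + 1)) : Fin (L.length + 1) :=
  if h : (p : ℕ) % 2 = t ∧ (p : ℕ) < L.length then ⟨p + 1, by omega⟩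
  else if (p : ℕ) % 2 = t then p else ⟨p - 1, by omega⟩

theorem arrowNbr_arrowNbr (L : List ℤ) (t : Fin 2) (p : Fin (L.length + 1)) :
    arrowNbr L t (arrowNbr L t p) = p := by
  obtain ⟨p, hp⟩ := p
  have := t.2
  unfold arrowNbr
  by_cases h1 : p % 2 = t
  · by_cases h2 : p < L.length
    · have : ¬ ((p + 1) % 2 = (t : ℕ)) := by omega
      simp [h1, h2, this]
    · simp [h1, h2]
  · rcases p with - | p
    · simp [h1]
    · have h3 : p % 2 = t := by omega
      have h4 : p < L.length := by omega
      simp [h1, h3, h4]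

theorem arrowLen_arrowNbr (L : List ℤ) (t : Fin 2) (p : Fin (L.length + 1)) :
    arrowLen L t (arrowNbr L t p) = -arrowLen L t p := by
  obtain ⟨p, hp⟩ := p
  have := t.2
  unfold arrowLen arrowNbr
  by_cases h1 : p % 2 = t
  · by_cases h2 : p < L.length
    · have : ¬ ((p + 1) % 2 = (t : ℕ)) := by omega
      simp [h1, h2, this]
    · obtain rfl : p = L.length := by omega
      simp [h1]
  · rcases p with - | p
    · simp [h1]
    · have h3 : p % 2 = t := by omega
      simp [h1, h3]

theorem arrowLen_eq_zero_iff {L : List ℤ} (hL : ∀ b ∈ L, b ≠ 0) (t : Fin 2)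
    (p : Fin (L.length + 1)) : arrowLen L t p = 0 ↔
      ((p : ℕ) % 2 = t ∧ (p : ℕ) = L.length) ∨ ((p : ℕ) % 2 ≠ t ∧ (p : ℕ) = 0) := by
  have hne : ∀ k < L.length, L.getD k 0 ≠ 0 := fun k hk => by
    rw [List.getD_eq_getElem _ _ hk]
    exact hL _ (List.getElem_mem hk)
  obtain ⟨p, hp⟩ := p
  unfold arrowLen
  by_cases h1 : p % 2 = t
  · by_cases h2 : p = L.length
    · subst h2
      simp [h1]
    · have h3 := hne p (by omega)
      simp only [h1, h2, if_true]
      simpa using h3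
  · rcases p with - | p
    · simp [h1]
    · have h3 := hne p (by omega)
      simp only [h1, if_false]
      simpa using h3

theorem arrowNbr_eq_self {L : List ℤ} (hL : ∀ b ∈ L, b ≠ 0) {t : Fin 2}
    {p : Fin (L.length + 1)} (h : arrowLen L t p = 0) : arrowNbr L t p = p := by
  rw [arrowLen_eq_zero_iff hL] at h
  unfold arrowNbr
  ext
  split_ifs with h1 h2
  · omega
  · rfl
  · have h3 : (p : ℕ) = 0 := by omega
    simp [h3]

theorem val_arrowNbr_of_lt {L : List ℤ} {t : Fin 2} {p : Fin (L.length + 1)}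
    (ht : (p : ℕ) % 2 = t) (hp : (p : ℕ) < L.length) : (arrowNbr L t p : ℕ) = p + 1 := by
  simp [arrowNbr, ht, hp]

open Polynomial in
theorem axisMap_stdDm {L : List ℤ} (t : Fin 2) (i j : Fin (L.length + 1)) :
    axisMap t (stdDm L i j) = if j = arrowNbr L t i ∧ arrowLen L t i < 0
      then X ^ (arrowLen L t i).natAbs else 0 := by
  have hvar : ∀ k : ℕ, axisMap t (if k % 2 = 0 then Uv else Vv) =
      if k % 2 = t then X else 0 := by
    intro k
    rcases Nat.mod_two_eq_zero_or_one k with h | h <;> fin_cases t <;>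
      simp [h, axisMap_Uv, axisMap_Vv]
  obtain ⟨i, hi⟩ := i
  obtain ⟨j, hj⟩ := j
  have ht := t.2
  unfold stdDm arrowLen arrowNbr
  simp only [Fin.ext_iff]
  by_cases h1 : j = i + 1 ∧ L.getD i 0 < 0
  · rw [if_pos h1, map_pow, hvar]
    obtain ⟨rfl, h2⟩ := h1
    by_cases h3 : i % 2 = t
    · have h4 : i < L.length := by omega
      simpa [h3, h4] using h2
    · have h5 : (L.getD i 0).natAbs ≠ 0 := by omega
      simp only [h3, if_false, zero_pow h5]
      rw [if_neg]
      rintro ⟨h6, -⟩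
      simp at h6
      omega
  · rw [if_neg h1]
    by_cases h2 : i = j + 1 ∧ 0 < L.getD j 0
    · rw [if_pos h2, map_pow, hvar]
      obtain ⟨rfl, h2⟩ := h2
      by_cases h3 : j % 2 = t
      · have h4 : ¬ ((j + 1) % 2 = (t : ℕ)) := by omega
        simpa [h3, h4] using h2
      · have h5 : (L.getD j 0).natAbs ≠ 0 := by omega
        have h4 : (j + 1) % 2 = (t : ℕ) := by omega
        simp only [h3, if_false, zero_pow h5]
        rw [if_neg]
        rintro ⟨h6, -⟩
        simp only [h4, true_and, if_true] at h6
        split_ifs at h6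
        · simp at h6
          omega
        · simp at h6
    · rw [if_neg h2, map_zero, if_neg]
      rintro ⟨h3, h4⟩
      by_cases h5 : i % 2 = t
      · simp only [h5, true_and, if_true] at h3 h4
        by_cases h6 : i < L.length
        · simp [h6] at h3
          exact h1 ⟨h3, h4⟩
        · rw [List.getD_eq_default _ _ (by omega)] at h4
          omega
      · rcases i with - | i
        · simp [h5] at h4
        · simp [h5] at h3 h4
          subst h3
          exact h2 ⟨rfl, by simpa using h4⟩

theorem arrowLen_one_eq_zero_iff {L : List ℤ} (hL : IsStdSeq L) (p : Fin (L.length + 1)) :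
    arrowLen L 1 p = 0 ↔ p = 0 := by
  have heven := Nat.even_iff.1 hL.2
  rw [arrowLen_eq_zero_iff hL.1, Fin.ext_iff, Fin.val_one, Fin.val_zero]
  omega

theorem forall_of_arrowNbr {L : List ℤ} (P : Fin (L.length + 1) → Prop) (h0 : P 0)
    (hP : ∀ t p, P p → P (arrowNbr L t p)) (p : Fin (L.length + 1)) : P p := by
  obtain ⟨p, hp⟩ := p
  induction p with
  | zero => exact h0
  | succ p ih =>
    have hp' : p < L.length := Nat.succ_lt_succ_iff.1 hp
    let t : Fin 2 := ⟨p % 2, Nat.mod_lt _ two_pos⟩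
    let q : Fin (L.length + 1) := ⟨p, Nat.lt_succ_of_lt hp'⟩
    have h : arrowNbr L t q = ⟨p + 1, hp⟩ := Fin.ext (val_arrowNbr_of_lt rfl hp')
    exact h ▸ hP t q (ih q.2)

/-- The arrows of a standard complex, with the generator `x_0` of the `V`-tower. -/
theorem isMatched_stdCx {L : List ℤ} (hL : IsStdSeq L) :
    IsMatched (StdCx L) (arrowNbr L) (arrowLen L) (0 : Fin (L.length + 1)) where
  nbr_nbr := arrowNbr_arrowNbr L
  len_nbr := arrowLen_arrowNbr L
  nbr_eq_self _ _ := arrowNbr_eq_self hL.1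
  len_eq_zero_iff := arrowLen_one_eq_zero_iff hL
  axisMap_dm := axisMap_stdDm
  connected := forall_of_arrowNbr

/-- Any local map `f : C(b_1, …, b_n) → C(b_1, …, b_n)` from a
standard complex to itself is injective, and moreover is an isomorphism of bigraded
chain complexes over `R` (in particular, bijective and absolutely bigraded). -/
theorem local_self_map_of_standard_is_isomorphism (L : List ℤ) (hL : IsStdSeq L)
    (f : Msub (StdCx L) →ₗ[RUV] Msub (StdCx L))
    (hf : IsLocalMap (StdCx L) (StdCx L) f) :
    Function.Injective f ∧ Function.Bijective f ∧
      MapHomogShift (StdCx L) (StdCx L) f 0 0 := by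
  have hbij := (isMatched_stdCx hL).bijective_of_isLocalMap hf
  exact ⟨hbij.1, hbij, ((isMatched_stdCx hL).localMap_apply hf).2⟩
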